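/- For continuous relations ζ, η : (X,c) ⇸ (Y,d) between closure spaces, cl ζ = cl η if and only if c(ζ*(B)) = c(η*(B)) for every closed subset B of (Y,d). -/

import Mathlib

/-- The inverse-image operator `ζ*` of a relation `ζ ⊆ X × Y`. -/
def relStar {X Y : Type*} (ζ : Set (X × Y)) (B : Set Y) : Set X :=
  {x : X | ∃ y ∈ B, (x, y) ∈ ζ}

/-- The closure of a relation `ζ ⊆ X × Y` with respect to a closure operator
`c` on the powerset of `X`. -/
def clRel {X Y : Type*} (c : Set X → Set X) (ζ : Set (X × Y)) : Set (X × Y) :=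
  {p : X × Y | p.1 ∈ c {x : X | (x, p.2) ∈ ζ}}

theorem relStar_mono {X Y : Type*} (ζ : Set (X × Y)) {A B : Set Y} (h : A ⊆ B) :
    relStar ζ A ⊆ relStar ζ B :=
  fun _ ⟨y, hy, hxy⟩ => ⟨y, h hy, hxy⟩

theorem mem_clRel {X Y : Type*} (c : Set X → Set X) (ζ : Set (X × Y)) (x : X) (y : Y) :
    (x, y) ∈ clRel c ζ ↔ x ∈ c (relStar ζ {y}) := by
  simp [clRel, relStar]

/-- If `cl ζ ⊆ cl η`, then `c (ζ* B) ⊆ c (η* B)` for every `B`. -/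
theorem closure_relStar_subset_of_clRel_subset {X Y : Type*} {c : Set X → Set X}
    (hcmono : ∀ A B : Set X, A ⊆ B → c A ⊆ c B)
    (hcext : ∀ A : Set X, A ⊆ c A)
    (hcidem : ∀ A : Set X, c (c A) = c A)
    {ζ η : Set (X × Y)} (h : clRel c ζ ⊆ clRel c η) (B : Set Y) :
    c (relStar ζ B) ⊆ c (relStar η B) := by
  rw [← hcidem (relStar η B)]
  refine hcmono _ _ ?_
  rintro x ⟨y, hy, hxy⟩
  have hx : (x, y) ∈ clRel c η := h ((mem_clRel c ζ x y).2 (hcext _ ⟨y, rfl, hxy⟩))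
  exact hcmono _ _ (relStar_mono η (Set.singleton_subset_iff.2 hy)) ((mem_clRel c η x y).1 hx)

/-- A continuous relation satisfies `c (ζ* (d B)) = c (ζ* B)`. -/
theorem closure_relStar_closure {X Y : Type*} {c : Set X → Set X} {d : Set Y → Set Y}
    (hcmono : ∀ A B : Set X, A ⊆ B → c A ⊆ c B)
    (hcidem : ∀ A : Set X, c (c A) = c A)
    (hdext : ∀ A : Set Y, A ⊆ d A)
    {ζ : Set (X × Y)} (hζ : ∀ B : Set Y, relStar ζ (d B) ⊆ c (relStar ζ B)) (B : Set Y) :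
    c (relStar ζ (d B)) = c (relStar ζ B) :=
  ((hcmono _ _ (hζ B)).trans (hcidem _).subset).antisymm
    (hcmono _ _ (relStar_mono ζ (hdext B)))

/-- For continuous relations `ζ, η : (X,c) ⇸ (Y,d)`,
`cl ζ = cl η` iff `c (ζ* B) = c (η* B)` for every closed subset `B` of
`(Y, d)`. -/
theorem clRel_eq_iff {X Y : Type*}
    (c : Set X → Set X) (d : Set Y → Set Y)
    (hcmono : ∀ A B : Set X, A ⊆ B → c A ⊆ c B)
    (hcext : ∀ A : Set X, A ⊆ c A)
    (hcidem : ∀ A : Set X, c (c A) = c A)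
    (hdmono : ∀ A B : Set Y, A ⊆ B → d A ⊆ d B)
    (hdext : ∀ A : Set Y, A ⊆ d A)
    (hdidem : ∀ A : Set Y, d (d A) = d A)
    (ζ η : Set (X × Y))
    (hζ : ∀ B : Set Y, relStar ζ (d B) ⊆ c (relStar ζ B))
    (hη : ∀ B : Set Y, relStar η (d B) ⊆ c (relStar η B)) :
    clRel c ζ = clRel c η ↔
      ∀ B : Set Y, d B = B → c (relStar ζ B) = c (relStar η B) := by
  constructor
  · intro h B _
    exact (closure_relStar_subset_of_clRel_subset hcmono hcext hcidem h.subset B).antisymm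
      (closure_relStar_subset_of_clRel_subset hcmono hcext hcidem h.superset B)
  · intro h
    ext ⟨x, y⟩
    rw [mem_clRel, mem_clRel, ← closure_relStar_closure hcmono hcidem hdext hζ,
      ← closure_relStar_closure hcmono hcidem hdext hη, h _ (hdidem {y})]
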